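/- Let n ≥ 2 and let A be an n × n real matrix with all entries nonnegative and spectral radius ρ(A) > 0. Suppose that the second compound matrix C₂(A) — the matrix indexed by two-element subsets {i < j} of {1, …, n}, whose ({i,j},{k,l}) entry is the 2 × 2 minor A i k · A j l − A i l · A j k — has all entries nonnegative, and that r₂ := ρ(C₂(A)) > 0. Then, regarding the eigenvalues of A as the complex roots of its characteristic polynomial counted with multiplicity: (1) λ₁ := ρ(A) is an eigenvalue of A; (2) there exist eigenvalues α, β of A with α·β = r₂ and such that either α ≠ β, or α = β and α is a root of the characteristic polynomial of multiplicity at least 2; (3) if ρ(A) is the only eigenvalue of A of modulus ρ(A), then A has a real eigenvalue λ₂ with 0 < λ₂ ≤ λ₁ and λ₁·λ₂ = r₂, and λ₂ < λ₁ whenever λ₁ is a simple root of the characteristic polynomial; (4) if A has more than one eigenvalue of modulus ρ(A), then there exists an eigenvalue α of A with |α| = ρ(A) such that conj(α) is also an eigenvalue, α·conj(α) = r₂, and either α is non-real (a pair of complex conjugate eigenvalues on the spectral circle) or α is real and is a root of the characteristic polynomial of multiplicity at least 2. -/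

import Mathlib

open Polynomial

noncomputable section

/-- The eigenvalues of a real `n × n` matrix: the multiset of complex roots, with
multiplicity, of its characteristic polynomial. -/
def matrixEigs {m : Type*} [Fintype m] [DecidableEq m] (A : Matrix m m ℝ) : Multiset ℂ :=
  ((A.map (Complex.ofReal : ℝ → ℂ)).charpoly).roots

/-- The second compound matrix of `A`, indexed by pairs `i < j`:  its
`((i,j),(k,l))` entry is the `2 × 2` minor `A i k · A j l − A i l · A j k`. -/
def compound2 {n : ℕ} (A : Matrix (Fin n) (Fin n) ℝ) :
    Matrix {p : Fin n × Fin n // p.1 < p.2} {p : Fin n × Fin n // p.1 < p.2} ℝ :=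
  fun p q => A p.1.1 q.1.1 * A p.1.2 q.1.2 - A p.1.1 q.1.2 * A p.1.2 q.1.1

section Helpers

open Matrix

lemma gk_mem_roots {m : Type*} [Fintype m] [DecidableEq m] (M : Matrix m m ℂ) (z : ℂ) :
    z ∈ M.charpoly.roots ↔ (Matrix.scalar m z - M).det = 0 := by
  rw [Polynomial.mem_roots (Matrix.charpoly_monic M).ne_zero, Polynomial.IsRoot,
    Matrix.eval_charpoly]

lemma gk_mem_roots_right {m : Type*} [Fintype m] [DecidableEq m] (M : Matrix m m ℂ) (z : ℂ) :
    z ∈ M.charpoly.roots ↔ ∃ v, v ≠ 0 ∧ M *ᵥ v = z • v := by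
  rw [gk_mem_roots, ← Matrix.exists_mulVec_eq_zero_iff]
  refine exists_congr fun v => and_congr_right fun _ => ?_
  have : (Matrix.scalar m z) *ᵥ v = z • v := by
    ext i; simp [Matrix.scalar_apply, Matrix.mulVec_diagonal]
  rw [Matrix.sub_mulVec, this, sub_eq_zero, eq_comm]

lemma gk_mem_roots_left {m : Type*} [Fintype m] [DecidableEq m] (M : Matrix m m ℂ) (z : ℂ) :
    z ∈ M.charpoly.roots ↔ ∃ v, v ≠ 0 ∧ v ᵥ* M = z • v := by
  rw [gk_mem_roots, ← Matrix.exists_vecMul_eq_zero_iff]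
  refine exists_congr fun v => and_congr_right fun _ => ?_
  have : v ᵥ* (Matrix.scalar m z) = z • v := by
    ext i; simp [Matrix.scalar_apply, Matrix.vecMul_diagonal, mul_comm]
  rw [Matrix.vecMul_sub, this, sub_eq_zero, eq_comm]

/-- Sum over all ordered pairs, folded to the pairs `i < j`. -/
lemma gk_sum_pairs {n : ℕ} (G : Fin n → Fin n → ℂ) (hG : ∀ k, G k k = 0) :
    ∑ k, ∑ l, G k l
      = ∑ q : {p : Fin n × Fin n // p.1 < p.2}, (G q.1.1 q.1.2 + G q.1.2 q.1.1) := by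
  have h1 : ∑ q : {p : Fin n × Fin n // p.1 < p.2}, (G q.1.1 q.1.2 + G q.1.2 q.1.1)
      = ∑ p : Fin n × Fin n, if p.1 < p.2 then G p.1 p.2 + G p.2 p.1 else 0 := by
    rw [← Finset.sum_filter]
    exact (Finset.sum_subtype (Finset.univ.filter fun p : Fin n × Fin n => p.1 < p.2)
      (by simp) (fun p : Fin n × Fin n => G p.1 p.2 + G p.2 p.1)).symm
  rw [h1, Fintype.sum_prod_type]
  have h2 : ∑ k, ∑ l, (if k < l then G k l + G l k else 0)
      = ∑ k, ∑ l, (if k < l then G k l else 0) + ∑ k, ∑ l, (if k < l then G l k else 0) := by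
    rw [← Finset.sum_add_distrib]
    refine Finset.sum_congr rfl fun k _ => ?_
    rw [← Finset.sum_add_distrib]
    refine Finset.sum_congr rfl fun l _ => ?_
    split_ifs <;> simp
  rw [h2, Finset.sum_comm (f := fun k l => if k < l then G l k else 0),
    ← Finset.sum_add_distrib]
  refine Finset.sum_congr rfl fun k _ => ?_
  rw [← Finset.sum_add_distrib]
  refine Finset.sum_congr rfl fun l _ => ?_
  rcases lt_trichotomy k l with h | h | h
  · simp [h, h.not_gt]
  · subst h; simp [hG]
  · simp [h, h.not_gt]

/-- The wedge product of two vectors. -/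
def gkWedge {n : ℕ} (x y : Fin n → ℂ) : {p : Fin n × Fin n // p.1 < p.2} → ℂ :=
  fun p => x p.1.1 * y p.1.2 - x p.1.2 * y p.1.1

lemma gk_compound_wedge {n : ℕ} (A : Matrix (Fin n) (Fin n) ℝ) (x y : Fin n → ℂ) :
    ((compound2 A).map (Complex.ofReal : ℝ → ℂ)) *ᵥ gkWedge x y
      = gkWedge (A.map (Complex.ofReal : ℝ → ℂ) *ᵥ x) (A.map (Complex.ofReal : ℝ → ℂ) *ᵥ y) := by
  ext p
  have h := gk_sum_pairs (fun k l => (A p.1.1 k : ℂ) * (A p.1.2 l : ℂ) * (x k * y l - x l * y k))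
    (by intro k; ring)
  have h' : gkWedge (A.map (Complex.ofReal : ℝ → ℂ) *ᵥ x) (A.map (Complex.ofReal : ℝ → ℂ) *ᵥ y) p
      = ∑ k, ∑ l, (A p.1.1 k : ℂ) * (A p.1.2 l : ℂ) * (x k * y l - x l * y k) := by
    simp only [gkWedge, Matrix.mulVec, dotProduct, Matrix.map_apply]
    rw [mul_comm (∑ i, (A p.1.2 i : ℂ) * x i), Finset.sum_mul_sum, Finset.sum_mul_sum,
      ← Finset.sum_sub_distrib]
    refine Finset.sum_congr rfl fun k _ => ?_
    rw [← Finset.sum_sub_distrib]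
    refine Finset.sum_congr rfl fun l _ => ?_
    ring
  rw [h', h]
  simp only [Matrix.mulVec, dotProduct, Matrix.map_apply, compound2, gkWedge]
  refine Finset.sum_congr rfl fun q _ => ?_
  push_cast
  ring

lemma gk_wedge_ne_zero {n : ℕ} {x y : Fin n → ℂ} {a b : ℂ} (M : Matrix (Fin n) (Fin n) ℂ)
    (hx : x ≠ 0) (hy : y ≠ 0) (hxa : M *ᵥ x = a • x) (hyb : M *ᵥ y = b • y) (hab : a ≠ b) :
    gkWedge x y ≠ 0 := by
  intro h
  have key : ∀ i j, x i * y j = x j * y i := by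
    intro i j
    rcases lt_trichotomy i j with hij | hij | hij
    · have := congrFun h ⟨(i, j), hij⟩
      simpa [gkWedge, sub_eq_zero] using this
    · subst hij; rfl
    · have := congrFun h ⟨(j, i), hij⟩
      simp only [gkWedge, Pi.zero_apply, sub_eq_zero] at this
      exact this.symm
  obtain ⟨i, hi⟩ := Function.ne_iff.mp hx
  simp only [Pi.zero_apply] at hi
  have h1 : x i • y = y i • x := by
    ext j; simp only [Pi.smul_apply, smul_eq_mul]; rw [key, mul_comm]
  have h2 : (b - a) • (x i • y) = 0 := by
    have e1 : M *ᵥ (x i • y) = b • (x i • y) := by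
      rw [Matrix.mulVec_smul, hyb, smul_comm]
    have e2 : M *ᵥ (x i • y) = a • (x i • y) := by
      rw [h1, Matrix.mulVec_smul, hxa, smul_comm]
    rw [sub_smul, ← e1, ← e2, sub_self]
  rcases smul_eq_zero.mp h2 with h3 | h3
  · exact hab (sub_eq_zero.mp h3).symm
  · rcases smul_eq_zero.mp h3 with h4 | h4
    · exact hi h4
    · exact hy h4

/-- Products of distinct eigenvalues are eigenvalues of the compound. -/
lemma gk_mul_mem {n : ℕ} (A : Matrix (Fin n) (Fin n) ℝ) {a b : ℂ}
    (ha : a ∈ matrixEigs A) (hb : b ∈ matrixEigs A) (hab : a ≠ b) :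
    a * b ∈ matrixEigs (compound2 A) := by
  obtain ⟨x, hx, hxa⟩ := (gk_mem_roots_right _ _).1 ha
  obtain ⟨y, hy, hyb⟩ := (gk_mem_roots_right _ _).1 hb
  refine (gk_mem_roots_right _ _).2 ⟨gkWedge x y, gk_wedge_ne_zero _ hx hy hxa hyb hab, ?_⟩
  rw [gk_compound_wedge, hxa, hyb]
  ext p
  simp only [gkWedge, Pi.smul_apply, smul_eq_mul]
  ring

/-- Orthogonality of generalized eigenspaces. -/
lemma gk_orth {V : Type*} [AddCommGroup V] [Module ℂ V] (f : V →ₗ[ℂ] V)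
    (ω : V →ₗ[ℂ] V →ₗ[ℂ] ℂ) (μ a b : ℂ) (hω : ∀ x y, ω (f x) (f y) = μ * ω x y)
    (hab : a * b ≠ μ) : ∀ (N k l : ℕ), k + l ≤ N → ∀ x y,
      ((f - a • (1 : Module.End ℂ V)) ^ k) x = 0 → ((f - b • (1 : Module.End ℂ V)) ^ l) y = 0 →
      ω x y = 0 := by
  intro N
  induction N with
  | zero =>
    intro k l hkl x y hx _
    obtain rfl : k = 0 := by omega
    have : x = 0 := by simpa using hx
    simp [this]
  | succ N ih =>
    intro k l hkl x y hx hy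
    rcases k with _ | k
    · have : x = 0 := by simpa using hx
      simp [this]
    rcases l with _ | l
    · have : y = 0 := by simpa using hy
      simp [this]
    set x' := (f - a • (1 : Module.End ℂ V)) x with hx'
    set y' := (f - b • (1 : Module.End ℂ V)) y with hy'
    have hx1 : ((f - a • (1 : Module.End ℂ V)) ^ k) x' = 0 := by
      rw [pow_succ] at hx; exact hx
    have hy1 : ((f - b • (1 : Module.End ℂ V)) ^ l) y' = 0 := by
      rw [pow_succ] at hy; exact hy
    have e1 := ih k (l+1) (by omega) x' y hx1 hy
    have e2 := ih (k+1) l (by omega) x y' hx hy1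
    have e3 := ih k l (by omega) x' y' hx1 hy1
    have fx : f x = a • x + x' := by simp [hx']
    have fy : f y = b • y + y' := by simp [hy']
    have := hω x y
    rw [fx, fy] at this
    simp only [map_add, map_smul, LinearMap.add_apply, LinearMap.smul_apply, smul_eq_mul, e1, e2,
      e3] at this
    have h0 : (a * b - μ) * ω x y = 0 := by linear_combination this
    rcases mul_eq_zero.mp h0 with h | h
    · exact absurd (sub_eq_zero.mp h) hab
    · exact h

/-- Eigenvalues of the compound are products of two eigenvalues. -/
lemma gk_exists_factors {n : ℕ} (A : Matrix (Fin n) (Fin n) ℝ) {μ : ℂ}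
    (hμ : μ ∈ matrixEigs (compound2 A)) :
    ∃ α ∈ matrixEigs A, ∃ β ∈ matrixEigs A, α * β = μ ∧
      (α ≠ β ∨ (α = β ∧ 2 ≤ (matrixEigs A).count α)) := by
  obtain ⟨u, hu, huμ⟩ := (gk_mem_roots_left _ _).1 hμ
  set M := A.map (Complex.ofReal : ℝ → ℂ) with hM
  set f : Module.End ℂ (Fin n → ℂ) := Matrix.toLin' M with hf
  let ω : (Fin n → ℂ) →ₗ[ℂ] (Fin n → ℂ) →ₗ[ℂ] ℂ :=
    LinearMap.mk₂ ℂ (fun x y => u ⬝ᵥ gkWedge x y)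
      (by intro x x' y; rw [← dotProduct_add]; congr 1; ext p; simp [gkWedge]; ring)
      (by intro c x y; rw [← dotProduct_smul]; congr 1; ext p; simp [gkWedge]; ring)
      (by intro x y y'; rw [← dotProduct_add]; congr 1; ext p; simp [gkWedge]; ring)
      (by intro c x y; rw [← dotProduct_smul]; congr 1; ext p; simp [gkWedge]; ring)
  have hωdef : ∀ x y, ω x y = u ⬝ᵥ gkWedge x y := fun x y => rfl
  have hω : ∀ x y, ω (f x) (f y) = μ * ω x y := by
    intro x y
    rw [hωdef, hωdef, hf, Matrix.toLin'_apply, Matrix.toLin'_apply, hM, ← gk_compound_wedge,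
      Matrix.dotProduct_mulVec, huμ, smul_dotProduct, smul_eq_mul]
  have halt : ∀ x, ω x x = 0 := by
    intro x
    have : gkWedge x x = 0 := by ext p; simp [gkWedge]; ring
    rw [hωdef, this, dotProduct_zero]
  have hchar : f.charpoly = M.charpoly := Matrix.charpoly_toLin' M
  have hmem : ∀ (a : ℂ) (x : Fin n → ℂ), x ≠ 0 → x ∈ f.maxGenEigenspace a →
      a ∈ matrixEigs A := by
    intro a x hx hxa
    have hpos : 0 < Module.finrank ℂ (f.maxGenEigenspace a) := by
      rw [Module.finrank_pos_iff_exists_ne_zero]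
      exact ⟨⟨x, hxa⟩, fun h => hx (congrArg Subtype.val h)⟩
    rw [LinearMap.finrank_maxGenEigenspace_eq, hchar, ← Polynomial.count_roots] at hpos
    exact Multiset.count_pos.mp hpos
  have hex : ∃ a b x y, x ∈ f.maxGenEigenspace a ∧ y ∈ f.maxGenEigenspace b ∧ ω x y ≠ 0 := by
    by_contra! hcon
    have htop := Module.End.iSup_maxGenEigenspace_eq_top f
    have h1 : ∀ x y, ω x y = 0 := by
      intro x y
      have hx : x ∈ ⨆ a, f.maxGenEigenspace a := by rw [htop]; trivial
      have hy : y ∈ ⨆ a, f.maxGenEigenspace a := by rw [htop]; trivial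
      refine Submodule.iSup_induction _ (motive := fun x => ω x y = 0) hx ?_ (by simp) ?_
      · intro a x hx
        refine Submodule.iSup_induction _ (motive := fun y => ω x y = 0) hy ?_ (by simp) ?_
        · intro b y hy
          exact hcon a b x y hx hy
        · intro y y' h h'
          rw [map_add, h, h', add_zero]
      · intro x x' h h'
        rw [map_add, LinearMap.add_apply, h, h', add_zero]
    apply hu
    ext p
    have h2 := h1 (Pi.single p.1.1 1) (Pi.single p.1.2 1)
    rw [hωdef] at h2
    have h3 : gkWedge (Pi.single p.1.1 1) (Pi.single p.1.2 1) = Pi.single p 1 := by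
      ext q
      obtain ⟨⟨i, j⟩, hij⟩ := p
      obtain ⟨⟨k, l⟩, hkl⟩ := q
      simp only [gkWedge, Pi.single_apply, Subtype.mk.injEq, Prod.mk.injEq]
      simp only at hij hkl
      by_cases h1 : k = i <;> by_cases h2 : l = j <;> by_cases h3 : l = i <;>
        by_cases h4 : k = j <;> simp [h1, h2, h3, h4] <;> omega
    rw [h3, dotProduct_single, mul_one] at h2
    exact h2
  obtain ⟨a, b, x, y, hx, hy, hxy⟩ := hex
  have hx0 : x ≠ 0 := by rintro rfl; simp at hxy
  have hy0 : y ≠ 0 := by rintro rfl; simp at hxy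
  refine ⟨a, hmem a x hx0 hx, b, hmem b y hy0 hy, ?_, ?_⟩
  · by_contra hab
    obtain ⟨k, hk⟩ := (Module.End.mem_maxGenEigenspace f a x).1 hx
    obtain ⟨l, hl⟩ := (Module.End.mem_maxGenEigenspace f b y).1 hy
    exact hxy (gk_orth f ω μ a b hω hab (k + l) k l le_rfl x y hk hl)
  · by_cases hab : a = b
    · right
      refine ⟨hab, ?_⟩
      subst hab
      by_contra hlt
      have hfin : Module.finrank ℂ (f.maxGenEigenspace a) ≤ 1 := by
        rw [LinearMap.finrank_maxGenEigenspace_eq, hchar, ← Polynomial.count_roots]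
        exact Nat.lt_succ_iff.mp (not_le.mp hlt)
      obtain ⟨v, hv⟩ := finrank_le_one_iff.mp hfin
      obtain ⟨c, hc⟩ := hv ⟨x, hx⟩
      obtain ⟨d, hd⟩ := hv ⟨y, hy⟩
      have hc' : x = c • (v : Fin n → ℂ) := (congrArg Subtype.val hc).symm
      have hd' : y = d • (v : Fin n → ℂ) := (congrArg Subtype.val hd).symm
      apply hxy
      rw [hc', hd']
      simp [halt]
    · exact Or.inl hab

section Norms
open scoped Matrix.Norms.Operator

/-- Collatz–Wielandt bound. -/
lemma gk_collatz {m : Type*} [Fintype m] [DecidableEq m] (A : Matrix m m ℝ)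
    (hA : ∀ i j, 0 ≤ A i j) (u : m → ℝ) (hu : ∀ i, 0 ≤ u i) (hu0 : u ≠ 0) (t : ℝ) (ht : 0 ≤ t)
    (hAu : ∀ i, t * u i ≤ (A *ᵥ u) i) : ∃ z ∈ matrixEigs A, t ≤ ‖z‖ := by
  have hne : Nonempty m := by
    obtain ⟨i, _⟩ := Function.ne_iff.mp hu0
    exact ⟨i⟩
  set M := A.map (Complex.ofReal : ℝ → ℂ) with hM
  set U : m → ℂ := fun i => (u i : ℂ) with hU
  have hU0 : U ≠ 0 := by
    obtain ⟨i, hi⟩ := Function.ne_iff.mp hu0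
    exact Function.ne_iff.mpr ⟨i, by simpa [hU] using hi⟩
  have hpow : ∀ k : ℕ, ∃ w : m → ℝ, (∀ i, t ^ k * u i ≤ w i) ∧ (M ^ k) *ᵥ U = fun i => (w i : ℂ) := by
    intro k
    induction k with
    | zero => exact ⟨u, by simp, by simp [hU]⟩
    | succ k ih =>
      obtain ⟨w, hw, hwM⟩ := ih
      refine ⟨A *ᵥ w, ?_, ?_⟩
      · intro i
        calc t ^ (k+1) * u i = t ^ k * (t * u i) := by ring
          _ ≤ t ^ k * (A *ᵥ u) i := by gcongr; exact hAu i
          _ = ∑ j, A i j * (t ^ k * u j) := by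
            simp only [Matrix.mulVec, dotProduct, Finset.mul_sum]
            exact Finset.sum_congr rfl fun j _ => by ring
          _ ≤ ∑ j, A i j * w j :=
            Finset.sum_le_sum fun j _ => mul_le_mul_of_nonneg_left (hw j) (hA i j)
      · rw [pow_succ', ← Matrix.mulVec_mulVec, hwM]
        ext i
        simp [Matrix.mulVec, dotProduct, hM]
  have hnorm : ∀ k : ℕ, t ^ k ≤ ‖M ^ k‖ := by
    intro k
    obtain ⟨w, hw, hwM⟩ := hpow k
    have h1 : t ^ k * ‖U‖ ≤ ‖M ^ k‖ * ‖U‖ := by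
      refine le_trans ?_ (Matrix.linfty_opNorm_mulVec (M ^ k) U)
      have h2 : ‖((t ^ k : ℝ) : ℂ) • U‖ ≤ ‖(M ^ k) *ᵥ U‖ := by
        rw [pi_norm_le_iff_of_nonneg (norm_nonneg _)]
        intro i
        refine le_trans ?_ (norm_le_pi_norm _ i)
        rw [hwM]
        have h3 : 0 ≤ t ^ k * u i := mul_nonneg (pow_nonneg ht k) (hu i)
        simp only [Pi.smul_apply, smul_eq_mul, hU, ← Complex.ofReal_mul, Complex.norm_real,
          Real.norm_eq_abs]
        rw [abs_of_nonneg h3]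
        exact (hw i).trans (le_abs_self _)
      rwa [norm_smul, Complex.norm_real, Real.norm_eq_abs, abs_of_nonneg (pow_nonneg ht k)] at h2
    exact le_of_mul_le_mul_right h1 (norm_pos_iff.mpr hU0)
  have hsr : ENNReal.ofReal t ≤ spectralRadius ℂ M := by
    refine ge_of_tendsto (spectrum.pow_norm_pow_one_div_tendsto_nhds_spectralRadius M) ?_
    filter_upwards [Filter.eventually_ge_atTop 1] with k hk
    apply ENNReal.ofReal_le_ofReal
    have h1 : t = (t ^ k) ^ (1 / k : ℝ) := by
      rw [one_div, Real.pow_rpow_inv_natCast ht (by omega)]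
    rw [h1]
    exact Real.rpow_le_rpow (pow_nonneg ht k) (hnorm k) (by positivity)
  obtain ⟨z, hz, hzn⟩ := spectrum.exists_nnnorm_eq_spectralRadius M
  refine ⟨z, ?_, ?_⟩
  · refine (gk_mem_roots _ _).2 ?_
    rw [spectrum.mem_iff, Matrix.isUnit_iff_isUnit_det, isUnit_iff_ne_zero, not_not] at hz
    exact hz
  · rw [← hzn] at hsr
    rw [← coe_nnnorm]
    exact (ENNReal.ofReal_le_coe).1 hsr

end Norms

/-- Extracting the spectral radius. -/
lemma gk_sup {m : Type*} [Fintype m] [DecidableEq m] (A : Matrix m m ℝ) (ρ : ℝ)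
    (hρ : ρ = sSup ((norm : ℂ → ℝ) '' {z : ℂ | z ∈ matrixEigs A})) (hpos : 0 < ρ) :
    (∃ z ∈ matrixEigs A, ‖z‖ = ρ) ∧ ∀ z ∈ matrixEigs A, ‖z‖ ≤ ρ := by
  have hfin : ((norm : ℂ → ℝ) '' {z : ℂ | z ∈ matrixEigs A}).Finite := by
    apply Set.Finite.image
    have : {z : ℂ | z ∈ matrixEigs A} = ((matrixEigs A).toFinset : Set ℂ) := by
      ext z; simp
    rw [this]
    exact Finset.finite_toSet _
  have hne : ((norm : ℂ → ℝ) '' {z : ℂ | z ∈ matrixEigs A}).Nonempty := by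
    by_contra h
    rw [Set.not_nonempty_iff_eq_empty] at h
    rw [h, Real.sSup_empty] at hρ
    linarith
  constructor
  · obtain ⟨z, hz, hzn⟩ := hne.csSup_mem hfin
    exact ⟨z, hz, by rw [hzn, ← hρ]⟩
  · intro z hz
    rw [hρ]
    exact le_csSup hfin.bddAbove ⟨z, hz, rfl⟩

/-- Weak Perron–Frobenius theorem. -/
lemma gk_perron {m : Type*} [Fintype m] [DecidableEq m] (A : Matrix m m ℝ)
    (hA : ∀ i j, 0 ≤ A i j) (ρ : ℝ)
    (hρ : ρ = sSup ((norm : ℂ → ℝ) '' {z : ℂ | z ∈ matrixEigs A})) (hpos : 0 < ρ) :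
    (ρ : ℂ) ∈ matrixEigs A := by
  obtain ⟨⟨z, hz, hzρ⟩, hle⟩ := gk_sup A ρ hρ hpos
  obtain ⟨x, hx0, hx⟩ := (gk_mem_roots_right _ _).1 hz
  set b : m → ℝ := fun i => ‖x i‖ with hb
  have hAb : ∀ i, ρ * b i ≤ (A *ᵥ b) i := by
    intro i
    have h1 := congrFun hx i
    calc ρ * b i = ‖(z • x) i‖ := by simp [hb, hzρ]
      _ = ‖∑ j, (A i j : ℂ) * x j‖ := by rw [← h1]; rfl
      _ ≤ ∑ j, ‖(A i j : ℂ) * x j‖ := norm_sum_le _ _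
      _ = ∑ j, A i j * b j := by
        refine Finset.sum_congr rfl fun j _ => ?_
        rw [norm_mul, Complex.norm_real, Real.norm_eq_abs, abs_of_nonneg (hA i j)]
  let R : ℝ → Matrix m m ℝ := fun t => Matrix.scalar m t - A
  have hR : ∀ t v i, (R t *ᵥ v) i = t * v i - (A *ᵥ v) i := by
    intro t v i
    simp [R, Matrix.sub_mulVec, Matrix.scalar_apply, Matrix.mulVec_diagonal]
  have hmono : ∀ t, ρ < t → ∀ y : m → ℝ, (∀ i, 0 ≤ (R t *ᵥ y) i) → ∀ i, 0 ≤ y i := by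
    intro t ht y hy
    by_contra! hneg
    obtain ⟨i0, hi0⟩ := hneg
    obtain ⟨w, hw, hwt⟩ := gk_collatz A hA (fun i => max (-y i) 0) (fun i => le_max_right _ _)
      (Function.ne_iff.mpr ⟨i0, by simp [hi0]⟩) t (by linarith) (by
        intro i
        have hnn : 0 ≤ (A *ᵥ fun i => max (-y i) 0) i :=
          Finset.sum_nonneg fun j _ => mul_nonneg (hA i j) (le_max_right _ _)
        have hge : -(A *ᵥ y) i ≤ (A *ᵥ fun i => max (-y i) 0) i := by
          simp only [Matrix.mulVec, dotProduct]
          rw [← Finset.sum_neg_distrib]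
          refine Finset.sum_le_sum fun j _ => ?_
          rw [← mul_neg]
          exact mul_le_mul_of_nonneg_left (le_max_left _ _) (hA i j)
        have h2 := hy i
        rw [hR] at h2
        rcases le_total (-y i) 0 with h | h
        · simpa [max_eq_right h] using hnn
        · rw [max_eq_left h]; linarith)
    linarith [hle w hw]
  have hdet : ∀ t, ((R t).det : ℂ) = (Matrix.scalar m (t : ℂ) - A.map (Complex.ofReal : ℝ → ℂ)).det := by
    intro t
    have h1 := RingHom.map_det Complex.ofRealHom (R t)
    rw [Complex.ofRealHom_eq_coe] at h1
    rw [h1]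
    congr 1
    ext i j
    by_cases hij : i = j <;> simp [R, Matrix.scalar_apply, Matrix.diagonal_apply, hij]
  have key : ∀ t, ρ < t → ∀ i,
      |(R t).det| * b i ≤ (t - ρ) * |((R t).adjugate *ᵥ b) i| := by
    intro t ht i
    have hd : (R t).det ≠ 0 := by
      intro h0
      have h1 : (t : ℂ) ∈ matrixEigs A := by
        refine (gk_mem_roots _ _).2 ?_
        rw [← hdet, h0, Complex.ofReal_zero]
      have := hle _ h1
      rw [Complex.norm_real, Real.norm_eq_abs] at this
      linarith [le_abs_self t]
    set Y := (R t).adjugate *ᵥ b with hY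
    have hRY : R t *ᵥ Y = (R t).det • b := by
      rw [hY, Matrix.mulVec_mulVec, Matrix.mul_adjugate, Matrix.smul_mulVec, Matrix.one_mulVec]
    have h3 := hmono t ht ((t - ρ) • ((R t).det⁻¹ • Y) - b) (by
      intro j
      rw [Matrix.mulVec_sub, Matrix.mulVec_smul, Matrix.mulVec_smul, hRY, smul_smul _ _ b,
        inv_mul_cancel₀ hd, one_smul, Pi.sub_apply, hR]
      simp only [Pi.smul_apply, smul_eq_mul]
      linarith [hAb j]) i
    simp only [Pi.sub_apply, Pi.smul_apply, smul_eq_mul] at h3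
    have h4 : b i ≤ (t - ρ) * (|(R t).det|⁻¹ * |Y i|) := by
      rw [← abs_inv, ← abs_mul]
      have := le_abs_self ((R t).det⁻¹ * Y i)
      nlinarith
    have hd' : 0 < |(R t).det| := abs_pos.mpr hd
    calc |(R t).det| * b i ≤ |(R t).det| * ((t - ρ) * (|(R t).det|⁻¹ * |Y i|)) := by gcongr
      _ = (t - ρ) * |Y i| := by field_simp
  obtain ⟨i, hi⟩ := Function.ne_iff.mp hx0
  have hbi : 0 < b i := norm_pos_iff.mpr hi
  have hRc : Continuous R := by
    refine Continuous.sub ?_ continuous_const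
    exact continuous_matrix fun i j => by
      by_cases hij : i = j
      · subst hij; simpa [Matrix.scalar_apply] using continuous_id'
      · simpa [Matrix.scalar_apply, Matrix.diagonal_apply, hij] using continuous_const
  have hc1 : Continuous fun t => |(R t).det| * b i :=
    (hRc.matrix_det.abs).mul continuous_const
  have hc2 : Continuous fun t => (t - ρ) * |((R t).adjugate *ᵥ b) i| := by
    refine (continuous_id.sub continuous_const).mul ?_
    exact ((continuous_apply i).comp (hRc.matrix_adjugate.matrix_mulVec continuous_const)).abs
  have hlim : |(R ρ).det| * b i ≤ (ρ - ρ) * |((R ρ).adjugate *ᵥ b) i| := by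
    refine le_of_tendsto_of_tendsto (b := nhdsWithin ρ (Set.Ioi ρ))
      (hc1.continuousAt.tendsto.mono_left nhdsWithin_le_nhds)
      (hc2.continuousAt.tendsto.mono_left nhdsWithin_le_nhds) ?_
    filter_upwards [self_mem_nhdsWithin] with t ht
    exact key t ht i
  rw [sub_self, zero_mul] at hlim
  have h0 : (R ρ).det = 0 := by
    by_contra h
    have : 0 < |(R ρ).det| * b i := mul_pos (abs_pos.mpr h) hbi
    linarith
  refine (gk_mem_roots _ _).2 ?_
  rw [← hdet, h0, Complex.ofReal_zero]

end Helpers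

/-- **Gantmakher–Krein theorem for 2-totally nonnegative matrices
(the matrix instance of Theorem 3 of the paper).**
Let `A` be an `n × n` (`n ≥ 2`) entrywise nonnegative real matrix with spectral radius
`ρ > 0` whose second compound matrix `C₂(A)` is also entrywise nonnegative with spectral
radius `r₂ > 0`.  Then, regarding the eigenvalues of `A` as complex roots of the characteristic
polynomial counted with multiplicity:
(1) `λ₁ = ρ(A)` is an eigenvalue of `A`;  (2) `r₂` is a product of two eigenvalues of `A`
(distinct or one of multiplicity `≥ 2`);  (3) if `ρ(A)` is the only eigenvalue of
modulus `ρ(A)` then `A` has a second positive eigenvalue `λ₂ ≤ λ₁` with `λ₁λ₂ = r₂`,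
and `λ₂ < λ₁` if `λ₁` is a simple root;  (4) otherwise the spectral circle carries an
eigenvalue `α` with `conj α` also an eigenvalue, `α·conj α = r₂`, and `α` is either
non-real or real of multiplicity at least `2`. -/
theorem gantmakherKrein_matrix
    {n : ℕ} (hn : 2 ≤ n) (A : Matrix (Fin n) (Fin n) ℝ)
    (hAnn : ∀ i j, 0 ≤ A i j)
    (ρ : ℝ) (hρ : ρ = sSup ((norm : ℂ → ℝ) '' {z : ℂ | z ∈ matrixEigs A}))
    (hρpos : 0 < ρ)
    (hC₂nn : ∀ p q, 0 ≤ compound2 A p q)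
    (r₂ : ℝ) (hr₂ : r₂ = sSup ((norm : ℂ → ℝ) '' {z : ℂ | z ∈ matrixEigs (compound2 A)}))
    (hr₂pos : 0 < r₂) :
    ((ρ : ℂ) ∈ matrixEigs A) ∧
    (∃ α ∈ matrixEigs A, ∃ β ∈ matrixEigs A, α * β = (r₂ : ℂ) ∧
      (α ≠ β ∨ (α = β ∧ 2 ≤ (matrixEigs A).count α))) ∧
    ((∀ z ∈ matrixEigs A, ‖z‖ = ρ → z = (ρ : ℂ)) →
      ∃ lam2 : ℝ, (lam2 : ℂ) ∈ matrixEigs A ∧ 0 < lam2 ∧ lam2 ≤ ρ ∧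
        ρ * lam2 = r₂ ∧ ((matrixEigs A).count (ρ : ℂ) = 1 → lam2 < ρ)) ∧
    ((∃ z ∈ matrixEigs A, ∃ w ∈ matrixEigs A,
        ‖z‖ = ρ ∧ ‖w‖ = ρ ∧ z ≠ w) →
      ∃ α ∈ matrixEigs A, ‖α‖ = ρ ∧
        (starRingEnd ℂ) α ∈ matrixEigs A ∧ α * (starRingEnd ℂ) α = (r₂ : ℂ) ∧
        (α.im ≠ 0 ∨ (α.im = 0 ∧ 2 ≤ (matrixEigs A).count α))) := by
  obtain ⟨⟨z₁, hz₁, hz₁n⟩, hle⟩ := gk_sup A ρ hρ hρpos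
  have hle₂ := (gk_sup (compound2 A) r₂ hr₂ hr₂pos).2
  have h1 := gk_perron A hAnn ρ hρ hρpos
  have h2 := gk_exists_factors A (gk_perron (compound2 A) hC₂nn r₂ hr₂ hr₂pos)
  refine ⟨h1, h2, ?_, ?_⟩
  · intro huniq
    obtain ⟨α, hα, β, hβ, hαβ, hor⟩ := h2
    have hprod : ‖α‖ * ‖β‖ = r₂ := by
      rw [← norm_mul, hαβ, Complex.norm_real, Real.norm_eq_abs, abs_of_pos hr₂pos]
    have hρ0 : (ρ : ℂ) ≠ 0 := by exact_mod_cast hρpos.ne'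
    have fin : ∀ γ ∈ matrixEigs A, (ρ : ℂ) * γ = r₂ →
        ((matrixEigs A).count (ρ : ℂ) = 1 → γ ≠ ρ) →
        ∃ lam2 : ℝ, (lam2 : ℂ) ∈ matrixEigs A ∧ 0 < lam2 ∧ lam2 ≤ ρ ∧
        ρ * lam2 = r₂ ∧ ((matrixEigs A).count (ρ : ℂ) = 1 → lam2 < ρ) := by
      intro γ hγ hγr hs
      have hγe : γ = ((r₂ / ρ : ℝ) : ℂ) := by
        push_cast
        rw [eq_div_iff hρ0, mul_comm, hγr]
      have hpos : 0 < r₂ / ρ := div_pos hr₂pos hρpos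
      have hl : r₂ / ρ ≤ ρ := by
        have := hle γ hγ
        rwa [hγe, Complex.norm_real, Real.norm_eq_abs, abs_of_pos hpos] at this
      refine ⟨r₂ / ρ, hγe ▸ hγ, hpos, hl, by field_simp, fun hc => lt_of_le_of_ne hl ?_⟩
      intro he
      exact hs hc (by rw [hγe, he])
    by_cases hαn : ‖α‖ = ρ
    · have hαρ := huniq α hα hαn
      refine fin β hβ (by rw [← hαρ, hαβ]) ?_
      intro hc he
      rcases hor with h | ⟨_, h⟩
      · exact h (by rw [hαρ, he])
      · rw [hαρ, hc] at h; omega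
    by_cases hβn : ‖β‖ = ρ
    · have hβρ := huniq β hβ hβn
      refine fin α hα (by rw [← hβρ, mul_comm, hαβ]) ?_
      intro hc he
      rcases hor with h | ⟨h', h⟩
      · exact h (by rw [hβρ, he])
      · rw [he, hc] at h; omega
    exfalso
    have hα' : ‖α‖ < ρ := lt_of_le_of_ne (hle α hα) hαn
    have hβ' : ‖β‖ < ρ := lt_of_le_of_ne (hle β hβ) hβn
    have hne : (ρ : ℂ) ≠ α := by
      rintro rfl
      rw [Complex.norm_real, Real.norm_eq_abs, abs_of_pos hρpos] at hα'
      exact lt_irrefl _ hα'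
    have h3 := hle₂ _ (gk_mul_mem A h1 hα hne)
    rw [norm_mul, Complex.norm_real, Real.norm_eq_abs, abs_of_pos hρpos] at h3
    have hαpos : 0 < ‖α‖ := by
      rcases (norm_nonneg α).eq_or_lt with h | h
      · rw [← h, zero_mul] at hprod; linarith
      · exact h
    nlinarith
  · rintro ⟨z, hz, w, hw, hzn, hwn, hzw⟩
    obtain ⟨α, hα, β, hβ, hαβ, hor⟩ := h2
    have hprod : ‖α‖ * ‖β‖ = r₂ := by
      rw [← norm_mul, hαβ, Complex.norm_real, Real.norm_eq_abs, abs_of_pos hr₂pos]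
    have h3 := hle₂ _ (gk_mul_mem A hz hw hzw)
    rw [norm_mul, hzn, hwn] at h3
    have ha := hle α hα
    have hb := hle β hβ
    have hαn : ‖α‖ = ρ := by
      refine le_antisymm ha ?_
      by_contra! h
      nlinarith [norm_nonneg α, norm_nonneg β]
    have hr : r₂ = ρ * ρ := by
      refine le_antisymm ?_ h3
      rw [← hprod, hαn]
      exact mul_le_mul_of_nonneg_left hb hρpos.le
    have hcc : α * (starRingEnd ℂ) α = (r₂ : ℂ) := by
      rw [Complex.mul_conj, Complex.normSq_eq_norm_sq, hαn, hr, sq]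
    have hα0 : α ≠ 0 := by
      intro h
      rw [h, norm_zero] at hαn
      linarith
    have hβc : β = (starRingEnd ℂ) α := mul_left_cancel₀ hα0 (hαβ.trans hcc.symm)
    refine ⟨α, hα, hαn, hβc ▸ hβ, hcc, ?_⟩
    by_cases him : α.im = 0
    · right
      refine ⟨him, ?_⟩
      rcases hor with h | ⟨_, h⟩
      · exact absurd (by rw [hβc]; exact (Complex.conj_eq_iff_im.mpr him).symm) h
      · exact h
    · exact Or.inl him

end
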